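/- For every integer n ≥ 1 and every finite field F with q elements, the number of ideals I of the Laurent polynomial algebra A = F[x,y,x⁻¹,y⁻¹] (the group algebra of ℤ × ℤ over F, i.e. AddMonoidAlgebra F (ℤ × ℤ)) with dim_F(A/I) = n equals Σ_{λ ⊢ n} (q−1)^{2v(λ)} · q^{n−ℓ(λ)} · Π_{i distinct part size of λ} (q^{2e_i(λ)} − 1)/(q² − 1), where the sum is over all partitions λ of n. -/

import Mathlib

namespace LaurentCount
open Polynomial

open PowerSeries PowerSeries.WithPiTopology in
theorem partition_sum (w Z : ℕ → ℕ → ℚ)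
    (hZ0 : ∀ n, Z 0 n = if n = 0 then 1 else 0)
    (hZ : ∀ m n, Z (m + 1) n = ∑ t ∈ Finset.range (n + 1),
      if (m + 1) * t ≤ n then (if t = 0 then 1 else w (m + 1) t) * Z m (n - (m + 1) * t) else 0)
    (n : ℕ) : Z n n = ∑ p : n.Partition, p.parts.toFinsupp.prod w := by
  have hcoeff : ∀ m k, PowerSeries.coeff k
      (1 + ∑' j, w (m + 1) (j + 1) • (PowerSeries.X : PowerSeries ℚ) ^ ((m + 1) * (j + 1))) =
      ∑ t ∈ Finset.range (k + 1), if k = (m + 1) * t then (if t = 0 then 1 else w (m + 1) t)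
        else 0 := by
    intro m k
    rw [map_add, (Nat.Partition.summable_genFun_term w m).map_tsum _
      (WithPiTopology.continuous_coeff _ _), Finset.sum_range_succ']
    rw [add_comm]
    congr 1
    · rw [tsum_eq_sum (s := Finset.range k)]
      · refine Finset.sum_congr rfl fun j _ => ?_
        simp [PowerSeries.coeff_X_pow]
      · intro j hj
        have : k ≠ (m + 1) * (j + 1) := by
          simp only [Finset.mem_range, not_lt] at hj
          nlinarith
        simp [PowerSeries.coeff_X_pow, this]
    · simp [PowerSeries.coeff_one]
  have hprod : ∀ m k, PowerSeries.coeff k (∏ i ∈ Finset.range m,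
      (1 + ∑' j, w (i + 1) (j + 1) • (PowerSeries.X : PowerSeries ℚ) ^ ((i + 1) * (j + 1)))) =
      Z m k := by
    intro m
    induction m with
    | zero => intro k; simp [hZ0, PowerSeries.coeff_one]
    | succ m ih =>
      intro k
      rw [Finset.prod_range_succ, mul_comm, PowerSeries.coeff_mul, hZ]
      simp only [ih, hcoeff]
      rw [Finset.Nat.sum_antidiagonal_eq_sum_range_succ_mk]
      simp only [Finset.sum_mul]
      have : ∀ a ∈ Finset.range (k + 1), (∑ t ∈ Finset.range (a + 1),
          (if a = (m + 1) * t then (if t = 0 then (1 : ℚ) else w (m + 1) t) else 0) * Z m (k - a))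
          = ∑ t ∈ Finset.range (k + 1),
          (if a = (m + 1) * t then (if t = 0 then (1 : ℚ) else w (m + 1) t) * Z m (k - a)
            else 0) := by
        intro a ha
        simp only [ite_mul, zero_mul]
        refine Finset.sum_subset (Finset.range_mono (by simp at ha; omega)) ?_
        intro t _ ht
        rw [if_neg]
        simp only [Finset.mem_range, not_lt] at ht
        nlinarith
      rw [Finset.sum_congr rfl this, Finset.sum_comm]
      refine Finset.sum_congr rfl fun t _ => ?_
      rw [Finset.sum_ite_eq' (Finset.range (k+1)) ((m + 1) * t)]
      simp only [Finset.mem_range, Nat.lt_succ_iff]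
  have hconst : ∀ m, n ≤ m → Z m n = Z n n := by
    intro m hm
    induction m, hm using Nat.le_induction with
    | base => rfl
    | succ m hm ih =>
      rw [hZ, Finset.sum_eq_single 0]
      · simp [ih]
      · intro t _ ht
        rw [if_neg]
        have : 1 ≤ t := by omega
        nlinarith
      · simp
  have h := (Nat.Partition.hasProd_genFun w).tendsto_prod_nat
  have h2 := (WithPiTopology.tendsto_iff_coeff_tendsto ℚ _ _ _).1 h n
  simp only [hprod, Nat.Partition.coeff_genFun] at h2
  refine tendsto_nhds_unique (tendsto_const_nhds.congr' ?_) h2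
  filter_upwards [Filter.eventually_ge_atTop n] with m hm using (hconst m hm).symm

end LaurentCount

namespace LaurentCount
open Polynomial

theorem card_preimage {A B : Type*} [AddGroup A] [AddGroup B] (ψ : A →+ B)
    (hψ : Function.Surjective ψ) (p : B → Prop) :
    Nat.card {x : A // p (ψ x)} = Nat.card ψ.ker * Nat.card {y : B // p y} := by
  choose s hs using hψ
  rw [← Nat.card_prod]
  refine Nat.card_congr
    { toFun := fun x => (⟨x.1 - s (ψ x.1), by simp [AddMonoidHom.mem_ker, hs]⟩, ⟨ψ x.1, x.2⟩)
      invFun := fun z => ⟨z.1.1 + s z.2.1, by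
        have := z.1.2
        rw [AddMonoidHom.mem_ker] at this
        rw [map_add, this, hs, zero_add]; exact z.2.2⟩
      left_inv := fun x => by simp
      right_inv := fun z => by
        have := z.1.2
        rw [AddMonoidHom.mem_ker] at this
        ext <;> simp [this, hs] }

section
variable {R : Type*} [CommRing R]

/-- polynomials in `I` of degree `≤ m` -/
noncomputable def low (m : ℕ) (I : Ideal R[X]) : AddSubgroup R[X] :=
  I.toAddSubgroup ⊓ (degreeLT R (m + 1)).toAddSubgroup

theorem mem_low {m : ℕ} {I : Ideal R[X]} {h : R[X]} : h ∈ low m I ↔ h ∈ I ∧ h.natDegree ≤ m := by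
  have : h.degree < ((m + 1 : ℕ) : WithBot ℕ) ↔ h.natDegree ≤ m := by
    rw [degree_lt_iff_coeff_zero, natDegree_le_iff_coeff_eq_zero]
    exact Iff.rfl
  simp [low, AddSubgroup.mem_inf, mem_degreeLT, ← this]

theorem low_top_eq {m : ℕ} : low m (⊤ : Ideal R[X]) = (degreeLT R (m + 1)).toAddSubgroup := by
  ext h; simp [low]

/-- colon ideal by a constant -/
noncomputable def col (c : R) (I : Ideal R[X]) : Ideal R[X] :=
  Submodule.comap (LinearMap.mulLeft R[X] (C c)) I

theorem mem_col {c : R} {I : Ideal R[X]} {h : R[X]} : h ∈ col c I ↔ C c * h ∈ I := Iff.rfl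

/-- leading coefficient ideal -/
noncomputable def lead (m : ℕ) (I : Ideal R[X]) : Ideal R :=
  (I.restrictScalars R ⊓ degreeLT R (m + 1)).map (lcoeff R m)

theorem mem_lead {m : ℕ} {I : Ideal R[X]} {x : R} :
    x ∈ lead m I ↔ ∃ h ∈ low m I, h.coeff m = x := by
  simp [lead, low]

theorem sub_natDegree_le {m : ℕ} {f g : R[X]} (hf : f.Monic) (hg : g.Monic)
    (hfm : f.natDegree = m + 1) (hgm : g.natDegree = m + 1) : (f - g).natDegree ≤ m := by
  rw [natDegree_le_iff_coeff_eq_zero]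
  intro N hN
  rcases Nat.lt_or_ge (m + 1) N with h | h
  · rw [coeff_sub, coeff_eq_zero_of_natDegree_lt (by omega),
      coeff_eq_zero_of_natDegree_lt (by omega), sub_zero]
  · obtain rfl : N = m + 1 := by omega
    have h1 := hf.coeff_natDegree
    have h2 := hg.coeff_natDegree
    rw [hfm] at h1
    rw [hgm] at h2
    rw [coeff_sub, h1, h2, sub_self]

theorem exists_rem [Nontrivial R] {m : ℕ} {f : R[X]} (hf : f.Monic) (hfm : f.natDegree = m + 1)
    (h : R[X]) : ∃ r s : R[X], h = r + f * s ∧ r.natDegree ≤ m := by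
  refine ⟨h %ₘ f, h /ₘ f, (modByMonic_add_div h f).symm, ?_⟩
  have := natDegree_modByMonic_lt h hf (by rintro rfl; simp at hfm)
  omega

theorem index_eq_low [Nontrivial R] {m : ℕ} {I : Ideal R[X]} {f : R[X]} (hfI : f ∈ I)
    (hf : f.Monic) (hfm : f.natDegree = m + 1) :
    I.toAddSubgroup.index = (low m I).relIndex (low m ⊤) := by
  rw [low_top_eq, low, AddSubgroup.inf_relIndex_right, ← AddSubgroup.relIndex_sup_left,
    ← AddSubgroup.relIndex_top_right]
  congr 1
  symm
  rw [eq_top_iff]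
  intro h _
  obtain ⟨r, s, rfl, hr⟩ := exists_rem hf hfm h
  rw [add_comm r]
  refine AddSubgroup.add_mem_sup (I.mul_mem_right _ hfI) ?_
  rw [← low_top_eq, mem_low]
  exact ⟨trivial, hr⟩

/-- multiplication by constant -/
noncomputable def mulC (c : R) : R[X] →+ R[X] := AddMonoidHom.mulLeft (C c)

theorem mulC_apply (c : R) (h : R[X]) : mulC c h = C c * h := rfl

theorem mulC_injective [IsDomain R] {c : R} (hc : c ≠ 0) : Function.Injective (mulC c) := by
  intro a b hab
  simp only [mulC_apply] at hab
  exact mul_left_cancel₀ (C_ne_zero.2 hc) hab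

theorem index_mulC_low (m : ℕ) (c : R) :
    ((low m (⊤ : Ideal R[X])).map (mulC c)).relIndex (low m ⊤) =
      (Nat.card (R ⧸ Ideal.span {c})) ^ (m + 1) := by
  let φ : R[X] →+ (Fin (m + 1) → R ⧸ Ideal.span {c}) :=
    { toFun := fun p i => Ideal.Quotient.mk _ (p.coeff i)
      map_zero' := by ext; simp
      map_add' := fun p q => by ext; simp }
  have h1 : φ.ker ⊓ low m ⊤ = (low m (⊤ : Ideal R[X])).map (mulC c) := by
    ext p
    simp only [AddSubgroup.mem_inf, AddMonoidHom.mem_ker, AddSubgroup.mem_map, mem_low,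
      Submodule.mem_top, true_and]
    constructor
    · rintro ⟨h, hp⟩
      have : ∀ i, c ∣ p.coeff i := by
        intro i
        rcases Nat.lt_or_ge i (m + 1) with hi | hi
        · have := congrFun h ⟨i, hi⟩
          simpa [φ, Ideal.Quotient.eq_zero_iff_mem, Ideal.mem_span_singleton] using this
        · rw [coeff_eq_zero_of_natDegree_lt (by omega)]; exact dvd_zero _
      choose a ha using this
      refine ⟨∑ i ∈ Finset.range (m + 1), monomial i (a i), ?_, ?_⟩
      · refine natDegree_sum_le_of_forall_le _ _ fun i hi => ?_
        exact (natDegree_monomial_le _).trans (by simp at hi; omega)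
      · ext j
        simp only [mulC_apply, coeff_C_mul, finsetSum_coeff, coeff_monomial]
        simp only [Finset.sum_ite_eq', Finset.mem_range]
        split_ifs with hj
        · exact (ha j).symm
        · rw [coeff_eq_zero_of_natDegree_lt (by omega), mul_zero]
    · rintro ⟨h, hh, rfl⟩
      refine ⟨?_, (natDegree_C_mul_le _ _).trans hh⟩
      ext i
      simp [φ, mulC_apply, Ideal.Quotient.eq_zero_iff_mem, Ideal.mem_span_singleton]
  have h2 : ∀ v, ∃ p ∈ low m (⊤ : Ideal R[X]), φ p = v := by
    intro v
    have : ∀ i, ∃ r, Ideal.Quotient.mk (Ideal.span {c}) r = v i :=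
      fun i => Ideal.Quotient.mk_surjective _
    choose a ha using this
    refine ⟨∑ i : Fin (m + 1), monomial (i : ℕ) (a i), mem_low.2 ⟨trivial, ?_⟩, ?_⟩
    · refine natDegree_sum_le_of_forall_le _ _ fun i hi => ?_
      exact (natDegree_monomial_le _).trans (by omega)
    · ext i
      simp only [φ, AddMonoidHom.coe_mk, ZeroHom.coe_mk, finsetSum_coeff, coeff_monomial,
        Fin.val_inj]
      simp [ha]
  rw [← h1, AddSubgroup.inf_relIndex_right]
  rw [← AddMonoidHom.comap_bot, AddSubgroup.relIndex_comap]
  have : (low m ⊤).map φ = ⊤ := by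
    rw [eq_top_iff]
    intro v _
    obtain ⟨p, hp, hv⟩ := h2 v
    exact ⟨p, hp, hv⟩
  rw [this, AddSubgroup.relIndex_top_right, AddSubgroup.index_bot, Nat.card_fun]
  simp

theorem relIndex_low [IsDomain R] (m : ℕ) {c : R} (hc : c ≠ 0) (I : Ideal R[X]) :
    ((low m I).map (mulC c)).relIndex (low m ⊤) =
      (low m I).relIndex (low m ⊤) * (Nat.card (R ⧸ Ideal.span {c})) ^ (m + 1) := by
  rw [← index_mulC_low, ← AddSubgroup.relIndex_map_map_of_injective (low m I) _ (mulC_injective hc),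
    AddSubgroup.relIndex_mul_relIndex]
  · refine AddSubgroup.map_mono ?_
    intro x hx
    rw [mem_low] at *
    exact ⟨trivial, hx.2⟩
  · rintro _ ⟨x, hx, rfl⟩
    have hx := mem_low.1 hx
    exact mem_low.2 ⟨trivial, (natDegree_C_mul_le _ _).trans hx.2⟩

theorem map_mulC_le (m : ℕ) (c : R) (I : Ideal R[X]) : (low m I).map (mulC c) ≤ low m I := by
  rintro _ ⟨x, hx, rfl⟩
  have hx := mem_low.1 hx
  exact mem_low.2 ⟨I.mul_mem_left _ hx.1, (natDegree_C_mul_le _ _).trans hx.2⟩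

theorem relIndex_low' [IsDomain R] (m : ℕ) {c : R} (hc : c ≠ 0) (I : Ideal R[X])
    (hI : (low m I).relIndex (low m ⊤) ≠ 0) :
    ((low m I).map (mulC c)).relIndex (low m I) =
      (Nat.card (R ⧸ Ideal.span {c})) ^ (m + 1) := by
  have h := relIndex_low m hc I
  rw [← AddSubgroup.relIndex_mul_relIndex _ _ _ (map_mulC_le m c I), mul_comm] at h
  · exact Nat.eq_of_mul_eq_mul_left (Nat.pos_of_ne_zero hI) h
  · intro x hx
    rw [mem_low] at *
    exact ⟨trivial, hx.2⟩

end
end LaurentCount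

namespace LaurentCount
open Polynomial
section
variable {R : Type*} [CommRing R]

/-- ideals containing a monic polynomial of degree `m`, with `X` invertible modulo `I`, and of
finite index -/
def Good (m : ℕ) (I : Ideal R[X]) : Prop :=
  (∃ f ∈ I, f.Monic ∧ f.natDegree = m) ∧ (∃ p ∈ I, p.coeff 0 = 1) ∧ I.toAddSubgroup.index ≠ 0

/-- the ideal `(f) + c I` -/
noncomputable def J (c : R) (I : Ideal R[X]) (f : R[X]) : Ideal R[X] :=
  Ideal.span {f} ⊔ Ideal.span {C c} * I

theorem mem_J {c : R} {I : Ideal R[X]} {f h : R[X]} :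
    h ∈ J c I f ↔ ∃ s, ∃ k ∈ I, h = f * s + C c * k := by
  rw [J, Submodule.mem_sup]
  constructor
  · rintro ⟨a, ha, b, hb, rfl⟩
    obtain ⟨s, rfl⟩ := Ideal.mem_span_singleton'.1 ha
    obtain ⟨k, hk, rfl⟩ := Ideal.mem_span_singleton_mul.1 hb
    exact ⟨s, k, hk, by ring⟩
  · rintro ⟨s, k, hk, rfl⟩
    exact ⟨f * s, Ideal.mem_span_singleton'.2 ⟨s, by ring⟩, C c * k,
      Ideal.mem_span_singleton_mul.2 ⟨k, hk, rfl⟩, rfl⟩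

theorem f_mem_J (c : R) (I : Ideal R[X]) (f : R[X]) : f ∈ J c I f :=
  mem_J.2 ⟨1, 0, I.zero_mem, by simp⟩

theorem J_le {c : R} {I : Ideal R[X]} {f : R[X]} (hf : f ∈ I) : J c I f ≤ I := by
  intro h hh
  obtain ⟨s, k, hk, rfl⟩ := mem_J.1 hh
  exact I.add_mem (I.mul_mem_right _ hf) (I.mul_mem_left _ hk)

theorem J_congr_le {c : R} {I : Ideal R[X]} {f f' : R[X]} {k : R[X]} (hk : k ∈ I)
    (h : f - f' = C c * k) : J c I f ≤ J c I f' := by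
  intro x hx
  obtain ⟨s, l, hl, rfl⟩ := mem_J.1 hx
  refine mem_J.2 ⟨s, k * s + l, I.add_mem (I.mul_mem_right _ hk) hl, ?_⟩
  rw [sub_eq_iff_eq_add] at h
  rw [h]; ring

theorem J_congr {c : R} {I : Ideal R[X]} {f f' : R[X]} {k : R[X]} (hk : k ∈ I)
    (h : f - f' = C c * k) : J c I f = J c I f' :=
  le_antisymm (J_congr_le hk h) (J_congr_le (I.neg_mem hk) (by rw [mul_neg, ← h]; ring))

variable [IsDomain R]

theorem low_J {m : ℕ} {c : R} {I : Ideal R[X]} {f : R[X]} (hfI : f ∈ I) (hf : f.Monic)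
    (hfm : f.natDegree = m + 1) : low m (J c I f) = (low m I).map (mulC c) := by
  ext h
  rw [mem_low, AddSubgroup.mem_map]
  constructor
  · rintro ⟨hh, hd⟩
    obtain ⟨s, k, hk, rfl⟩ := mem_J.1 hh
    obtain ⟨r, s', rfl, hr⟩ := exists_rem hf hfm k
    refine ⟨r, mem_low.2 ⟨?_, hr⟩, ?_⟩
    · exact (I.add_mem_iff_left (I.mul_mem_right _ hfI)).1 hk
    · have h0 : s + C c * s' = 0 := by
        by_contra hne
        have h1 : (f * (s + C c * s')).natDegree ≤ m := by
          have : f * (s + C c * s') = (f * s + C c * (r + f * s')) - C c * r := by ring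
          rw [this]
          exact (natDegree_sub_le _ _).trans (max_le hd ((natDegree_C_mul_le _ _).trans hr))
        rw [hf.natDegree_mul' hne] at h1
        omega
      rw [mulC_apply]
      linear_combination (-f) * h0
  · rintro ⟨k, hk, rfl⟩
    have hk := mem_low.1 hk
    exact ⟨mem_J.2 ⟨0, k, hk.1, by simp [mulC_apply]⟩, (natDegree_C_mul_le _ _).trans hk.2⟩

theorem lead_J {m : ℕ} {c : R} {I : Ideal R[X]} {f g : R[X]} (hfI : f ∈ I) (hf : f.Monic)
    (hfm : f.natDegree = m + 1) (hgI : g ∈ I) (hg : g.Monic) (hgm : g.natDegree = m) :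
    lead m (J c I f) = Ideal.span {c} := by
  ext x
  rw [mem_lead, low_J hfI hf hfm, Ideal.mem_span_singleton']
  constructor
  · rintro ⟨_, ⟨h, hh, rfl⟩, rfl⟩
    exact ⟨h.coeff m, by simp [mulC_apply, mul_comm]⟩
  · rintro ⟨a, rfl⟩
    refine ⟨_, ⟨C a * g, mem_low.2 ⟨I.mul_mem_left _ hgI, (natDegree_C_mul_le _ _).trans hgm.le⟩,
      rfl⟩, ?_⟩
    have := hg.coeff_natDegree
    rw [hgm] at this
    simp [mulC_apply, this, mul_comm]

theorem col_J {m : ℕ} {c : R} (hc : c ≠ 0) {I : Ideal R[X]} {f : R[X]} (hfI : f ∈ I) (hf : f.Monic)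
    (hfm : f.natDegree = m + 1) : col c (J c I f) = I := by
  ext h
  rw [mem_col]
  constructor
  · intro hh
    obtain ⟨r, s, rfl, hr⟩ := exists_rem hf hfm h
    refine I.add_mem ?_ (I.mul_mem_right _ hfI)
    have h1 : C c * r ∈ low m (J c I f) := by
      refine mem_low.2 ⟨?_, (natDegree_C_mul_le _ _).trans hr⟩
      have : C c * r = C c * (r + f * s) - f * (C c * s) := by ring
      rw [this]
      exact Ideal.sub_mem _ hh (Ideal.mul_mem_right _ _ (f_mem_J _ _ _))
    rw [low_J hfI hf hfm] at h1
    obtain ⟨r', hr', he⟩ := h1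
    have := mulC_injective hc (he.trans (mulC_apply c r).symm)
    rw [← this]
    exact (mem_low.1 hr').1
  · intro hh
    exact mem_J.2 ⟨0, h, hh, by simp⟩

theorem index_J {m : ℕ} {c : R} (hc : c ≠ 0) {I : Ideal R[X]} {f : R[X]} (hfI : f ∈ I)
    (hf : f.Monic) (hfm : f.natDegree = m + 1) :
    (J c I f).toAddSubgroup.index =
      I.toAddSubgroup.index * (Nat.card (R ⧸ Ideal.span {c})) ^ (m + 1) := by
  rw [index_eq_low (f_mem_J c I f) hf hfm, index_eq_low hfI hf hfm, low_J hfI hf hfm,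
    relIndex_low m hc]

theorem isUnit_mk_iff {c a : R} : IsUnit (Ideal.Quotient.mk (Ideal.span {c}) a) ↔
    ∃ x y, a * x + c * y = 1 := by
  rw [isUnit_iff_exists_inv]
  constructor
  · rintro ⟨b, hb⟩
    obtain ⟨x, rfl⟩ := Ideal.Quotient.mk_surjective b
    rw [← map_mul, ← map_one (Ideal.Quotient.mk _), Ideal.Quotient.eq,
      Ideal.mem_span_singleton'] at hb
    obtain ⟨y, hy⟩ := hb
    exact ⟨x, -y, by linear_combination -hy⟩
  · rintro ⟨x, y, h⟩
    refine ⟨Ideal.Quotient.mk _ x, ?_⟩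
    rw [← map_mul, ← map_one (Ideal.Quotient.mk _), Ideal.Quotient.eq,
      Ideal.mem_span_singleton']
    exact ⟨-y, by linear_combination -h⟩

theorem unit_J {c : R} {I : Ideal R[X]} {f : R[X]} (hfI : f ∈ I) :
    (∃ p ∈ J c I f, p.coeff 0 = 1) ↔
      (∃ p ∈ I, p.coeff 0 = 1) ∧ IsUnit (Ideal.Quotient.mk (Ideal.span {c}) (f.coeff 0)) := by
  rw [isUnit_mk_iff]
  constructor
  · rintro ⟨p, hp, hp1⟩
    refine ⟨⟨p, J_le hfI hp, hp1⟩, ?_⟩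
    obtain ⟨s, k, hk, rfl⟩ := mem_J.1 hp
    exact ⟨s.coeff 0, k.coeff 0, by simpa [mul_coeff_zero] using hp1⟩
  · rintro ⟨⟨p, hp, hp1⟩, x, y, h⟩
    refine ⟨f * C x + C c * (C y * p), mem_J.2 ⟨_, _, I.mul_mem_left _ hp, rfl⟩, ?_⟩
    simpa [mul_coeff_zero, hp1] using h

theorem le_col (c : R) (I : Ideal R[X]) : I ≤ col c I := fun _ hx => I.mul_mem_left _ hx

theorem coeff_mem_lead {m : ℕ} {I : Ideal R[X]} {f : R[X]} (hfI : f ∈ I) (hf : f.Monic)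
    (hfm : f.natDegree = m + 1) (k : ℕ) : ∀ h ∈ low m I, h.coeff (m - k) ∈ lead m I := by
  induction k with
  | zero => intro h hh; exact mem_lead.2 ⟨h, hh, rfl⟩
  | succ k ih =>
    intro h hh
    have htop : h.coeff m ∈ lead m I := mem_lead.2 ⟨h, hh, rfl⟩
    rcases Nat.lt_or_ge k m with hk | hk
    · have hfc := hf.coeff_natDegree
      rw [hfm] at hfc
      have h1 : X * h - C (h.coeff m) * f ∈ low m I := by
        have hh := mem_low.1 hh
        refine mem_low.2 ⟨I.sub_mem (I.mul_mem_left _ hh.1) (I.mul_mem_left _ hfI), ?_⟩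
        rw [natDegree_le_iff_coeff_eq_zero]
        intro N hN
        obtain ⟨N, rfl⟩ : ∃ N', N = N' + 1 := ⟨N - 1, by omega⟩
        rw [coeff_sub, coeff_X_mul, coeff_C_mul]
        rcases Nat.lt_or_ge m N with h2 | h2
        · rw [coeff_eq_zero_of_natDegree_lt (by omega),
            coeff_eq_zero_of_natDegree_lt (p := f) (by omega)]; simp
        · obtain rfl : N = m := by omega
          rw [hfc]; simp
      have h2 := ih _ h1
      obtain ⟨j, hj⟩ : ∃ j, m - k = j + 1 := ⟨m - k - 1, by omega⟩
      rw [hj, coeff_sub, coeff_X_mul, coeff_C_mul] at h2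
      have : m - (k + 1) = j := by omega
      rw [this]
      exact (Submodule.sub_mem_iff_left _ (Ideal.mul_mem_right _ _ htop)).1 h2
    · have := ih h hh
      rwa [show m - (k + 1) = m - k by omega]

theorem low_eq_map {m : ℕ} {c : R} {I : Ideal R[X]} {f : R[X]} (hfI : f ∈ I) (hf : f.Monic)
    (hfm : f.natDegree = m + 1) (hc : lead m I = Ideal.span {c}) {h : R[X]} (hh : h ∈ low m I) :
    ∃ k ∈ low m (col c I), h = C c * k := by
  have hd : ∀ i, ∃ a, i ≤ m → h.coeff i = c * a := by
    intro i
    by_cases hi : i ≤ m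
    · have := coeff_mem_lead hfI hf hfm (m - i) h hh
      rw [hc, Ideal.mem_span_singleton, show m - (m - i) = i by omega] at this
      obtain ⟨a, ha⟩ := this
      exact ⟨a, fun _ => ha⟩
    · exact ⟨0, fun h => absurd h hi⟩
  choose a ha using hd
  have he : h = C c * ∑ i ∈ Finset.range (m + 1), monomial i (a i) := by
    ext j
    simp only [coeff_C_mul, finsetSum_coeff, coeff_monomial]
    simp only [Finset.sum_ite_eq', Finset.mem_range]
    split_ifs with hj
    · exact ha j (by omega)
    · rw [coeff_eq_zero_of_natDegree_lt, mul_zero]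
      have := (mem_low.1 hh).2
      omega
  refine ⟨_, mem_low.2 ⟨?_, ?_⟩, he⟩
  · rw [mem_col, ← he]
    exact (mem_low.1 hh).1
  · refine natDegree_sum_le_of_forall_le _ _ fun i hi => ?_
    exact (natDegree_monomial_le _).trans (by simp at hi; omega)

theorem eq_J {m : ℕ} {c : R} {I : Ideal R[X]} {f : R[X]} (hfI : f ∈ I) (hf : f.Monic)
    (hfm : f.natDegree = m + 1) (hc : lead m I = Ideal.span {c}) :
    I = J c (col c I) f := by
  apply le_antisymm
  · intro h hh
    obtain ⟨r, s, rfl, hr⟩ := exists_rem hf hfm h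
    have hrI : r ∈ I := (I.add_mem_iff_left (I.mul_mem_right _ hfI)).1 hh
    obtain ⟨k, hk, rfl⟩ := low_eq_map hfI hf hfm hc (mem_low.2 ⟨hrI, hr⟩)
    exact mem_J.2 ⟨s, k, (mem_low.1 hk).1, by ring⟩
  · intro h hh
    obtain ⟨s, k, hk, rfl⟩ := mem_J.1 hh
    exact I.add_mem (I.mul_mem_right _ hfI) hk

theorem lead_ne_bot [Infinite R] {m : ℕ} {I : Ideal R[X]} (hI : I.toAddSubgroup.index ≠ 0) :
    lead m I ≠ ⊥ := by
  intro hbot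
  have hfin : Finite (R[X] ⧸ I) := Nat.finite_of_card_ne_zero hI
  have : ¬ Function.Injective (fun r : R => Ideal.Quotient.mk I (C r)) :=
    not_injective_infinite_finite _
  simp only [Function.Injective, not_forall] at this
  obtain ⟨a, b, hab, hne⟩ := this
  rw [Ideal.Quotient.eq, ← C_sub] at hab
  have : a - b ∈ lead m I := by
    refine mem_lead.2 ⟨C (a - b) * X ^ m, mem_low.2 ⟨I.mul_mem_right _ hab,
      natDegree_C_mul_X_pow_le _ _⟩, by rw [coeff_C_mul_X_pow, if_pos rfl]⟩
  rw [hbot, Submodule.mem_bot] at this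
  exact hne (sub_eq_zero.1 this)

theorem good_col [Infinite R] {m : ℕ} {c : R} {I : Ideal R[X]} (hI : Good (m + 1) I)
    (hc : lead m I = Ideal.span {c}) :
    c ≠ 0 ∧ Good m (col c I) ∧ I.toAddSubgroup.index =
      (col c I).toAddSubgroup.index * (Nat.card (R ⧸ Ideal.span {c})) ^ (m + 1) := by
  have hc0 : c ≠ 0 := by
    rintro rfl
    exact lead_ne_bot hI.2.2 (hc.trans (by simp))
  obtain ⟨⟨f, hfI, hf, hfm⟩, ⟨p, hp, hp1⟩, hidx⟩ := hI
  have hidx' : I.toAddSubgroup.index =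
      (col c I).toAddSubgroup.index * (Nat.card (R ⧸ Ideal.span {c})) ^ (m + 1) := by
    conv_lhs => rw [eq_J hfI hf hfm hc]
    exact index_J hc0 (le_col _ _ hfI) hf hfm
  refine ⟨hc0, ⟨?_, ⟨p, le_col _ _ hp, hp1⟩, ?_⟩, hidx'⟩
  · have : c ∈ lead m I := by rw [hc]; exact Ideal.mem_span_singleton_self c
    obtain ⟨h, hh, hcoef⟩ := mem_lead.1 this
    obtain ⟨k, hk, rfl⟩ := low_eq_map hfI hf hfm hc hh
    have hkm : k.coeff m = 1 := by
      rw [coeff_C_mul] at hcoef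
      exact mul_left_cancel₀ hc0 (hcoef.trans (mul_one c).symm)
    have hd : k.natDegree = m := le_antisymm (mem_low.1 hk).2
      (le_natDegree_of_ne_zero (by rw [hkm]; exact one_ne_zero))
    refine ⟨k, (mem_low.1 hk).1, ?_, hd⟩
    rw [Monic, leadingCoeff, hd, hkm]
  · intro h0
    rw [h0, zero_mul] at hidx'
    exact hidx hidx'

theorem monic_X_mul_add {m : ℕ} {g h : R[X]} (hg : g.Monic) (hgm : g.natDegree = m)
    (hh : h.natDegree ≤ m) : (X * g + h).Monic ∧ (X * g + h).natDegree = m + 1 := by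
  have h1 : (X * g).Monic := monic_X.mul hg
  have h2 : (X * g).natDegree = m + 1 := by
    rw [monic_X.natDegree_mul hg, natDegree_X, hgm, add_comm]
  have h3 : h.degree < (X * g).degree := by
    apply degree_lt_degree
    omega
  exact ⟨h1.add_of_left h3, by rw [natDegree_add_eq_left_of_degree_lt h3, h2]⟩

theorem fiber_card {m : ℕ} {c : R} (hc : c ≠ 0) {I' : Ideal R[X]} (hI' : Good m I')
    (hfin : Nat.card (R ⧸ Ideal.span {c}) ≠ 0) :
    Nat.card {I : Ideal R[X] // Good (m + 1) I ∧ lead m I = Ideal.span {c} ∧ col c I = I'} =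
      Nat.card (R ⧸ Ideal.span {c}) ^ m * Nat.card (R ⧸ Ideal.span {c})ˣ := by
  obtain ⟨⟨g, hgI, hg, hgm⟩, ⟨p, hp, hp1⟩, hidx⟩ := hI'
  have hX := monic_X_mul_add hg hgm (h := 0) (by simp)
  rw [add_zero] at hX
  have hXI : X * g ∈ I' := I'.mul_mem_left _ hgI
  set L := low m I' with hL
  set K := ((low m I').map (mulC c)).addSubgroupOf L with hK
  have hmemK : ∀ x : L, x ∈ K ↔ x.1 ∈ (low m I').map (mulC c) :=
    fun x => AddSubgroup.mem_addSubgroupOf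
  have hKcard : Nat.card (L ⧸ K) = (Nat.card (R ⧸ Ideal.span {c})) ^ (m + 1) := by
    rw [← relIndex_low' m hc I']
    · rfl
    · rw [← index_eq_low hXI hX.1 hX.2]; exact hidx
  let ψ0 : L →+ R ⧸ Ideal.span {c} :=
    { toFun := fun h => Ideal.Quotient.mk _ (h.1.coeff 0)
      map_zero' := by simp
      map_add' := fun a b => by simp }
  have hψ0 : K ≤ ψ0.ker := by
    intro x hx
    rw [hmemK] at hx
    obtain ⟨k, hk, he⟩ := hx
    rw [AddMonoidHom.mem_ker]
    show Ideal.Quotient.mk _ (x.1.coeff 0) = 0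
    rw [← he, Ideal.Quotient.eq_zero_iff_mem, Ideal.mem_span_singleton, mulC_apply]
    simp
  let ψ : L ⧸ K →+ R ⧸ Ideal.span {c} := QuotientAddGroup.lift K ψ0 hψ0
  have hψmk : ∀ h : L, ψ (QuotientAddGroup.mk h) = Ideal.Quotient.mk _ (h.1.coeff 0) :=
    fun h => rfl
  have hψ : Function.Surjective ψ := by
    intro y
    obtain ⟨y, rfl⟩ := Ideal.Quotient.mk_surjective y
    obtain ⟨r, s, hrs, hr⟩ := exists_rem hX.1 hX.2 p
    have hrI : r ∈ I' := by
      rw [hrs] at hp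
      exact (I'.add_mem_iff_left (I'.mul_mem_right _ hXI)).1 hp
    have hr1 : r.coeff 0 = 1 := by
      rw [hrs] at hp1
      simpa [mul_coeff_zero] using hp1
    refine ⟨QuotientAddGroup.mk ⟨C y * r, mem_low.2 ⟨I'.mul_mem_left _ hrI,
      (natDegree_C_mul_le _ _).trans hr⟩⟩, ?_⟩
    rw [hψmk]
    simp [hr1]
  have hcount := card_preimage ψ hψ (fun y => IsUnit y)
  have hcount1 := card_preimage ψ hψ (fun _ => True)
  have hunits : Nat.card {y : R ⧸ Ideal.span {c} // IsUnit y} = Nat.card (R ⧸ Ideal.span {c})ˣ :=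
    Nat.card_congr
      { toFun := fun y => y.2.unit
        invFun := fun u => ⟨u, u.isUnit⟩
        left_inv := fun y => rfl
        right_inv := fun u => by ext; rfl }
  have hker : Nat.card ψ.ker = Nat.card (R ⧸ Ideal.span {c}) ^ m := by
    simp only [Nat.card_congr (Equiv.subtypeUnivEquiv (fun _ => trivial))] at hcount1
    rw [hKcard, pow_succ] at hcount1
    exact (Nat.eq_of_mul_eq_mul_right (Nat.pos_of_ne_zero hfin) hcount1).symm
  rw [hunits, hker] at hcount
  rw [← hcount]
  symm
  have hout : ∀ x : L ⧸ K, X * g + x.out.1 ∈ I' ∧ (X * g + x.out.1).Monic ∧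
      (X * g + x.out.1).natDegree = m + 1 := by
    intro x
    have := mem_low.1 x.out.2
    exact ⟨I'.add_mem hXI this.1, monic_X_mul_add hg hgm this.2⟩
  have hψout : ∀ x : L ⧸ K, ψ x = Ideal.Quotient.mk _ ((X * g + x.out.1).coeff 0) := by
    intro x
    conv_lhs => rw [← QuotientAddGroup.out_eq' x]
    rw [hψmk]
    simp [mul_coeff_zero]
  refine Nat.card_congr (Equiv.ofBijective
    (fun x : {x : L ⧸ K // IsUnit (ψ x)} => ⟨J c I' (X * g + x.1.out.1), ?_⟩) ⟨?_, ?_⟩)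
  · obtain ⟨h1, h2, h3⟩ := hout x.1
    refine ⟨⟨⟨_, f_mem_J _ _ _, h2, h3⟩, ?_, ?_⟩, ?_, ?_⟩
    · rw [unit_J h1, ← hψout]
      exact ⟨⟨p, hp, hp1⟩, x.2⟩
    · rw [index_J hc h1 h2 h3]
      exact mul_ne_zero hidx (pow_ne_zero _ hfin)
    · exact lead_J h1 h2 h3 hgI hg hgm
    · exact col_J hc h1 h2 h3
  · intro x y hxy
    have hxy : J c I' (X * g + x.1.out.1) = J c I' (X * g + y.1.out.1) := congrArg Subtype.val hxy
    obtain ⟨h1, h2, h3⟩ := hout x.1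
    have hm : x.1.out.1 - y.1.out.1 ∈ low m (J c I' (X * g + x.1.out.1)) := by
      refine mem_low.2 ⟨?_, (natDegree_sub_le _ _).trans
        (max_le (mem_low.1 x.1.out.2).2 (mem_low.1 y.1.out.2).2)⟩
      have : x.1.out.1 - y.1.out.1 = (X * g + x.1.out.1) - (X * g + y.1.out.1) := by ring
      rw [this]
      refine Ideal.sub_mem _ (f_mem_J _ _ _) ?_
      rw [hxy]
      exact f_mem_J _ _ _
    rw [low_J h1 h2 h3] at hm
    apply Subtype.ext
    rw [← QuotientAddGroup.out_eq' x.1, ← QuotientAddGroup.out_eq' y.1]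
    rw [eq_comm, QuotientAddGroup.eq, hmemK]
    have : ((-y.1.out + x.1.out : L) : R[X]) = x.1.out.1 - y.1.out.1 := by
      push_cast; ring
    rw [this]
    exact hm
  · rintro ⟨I, ⟨⟨f, hfI, hf, hfm⟩, hu, hi⟩, hlead, hcol⟩
    have hfI' : f ∈ I' := by rw [← hcol]; exact le_col _ _ hfI
    have hJ := eq_J hfI hf hfm hlead
    rw [hcol] at hJ
    have hh : f - X * g ∈ L := mem_low.2 ⟨I'.sub_mem hfI' hXI, sub_natDegree_le hf hX.1 hfm hX.2⟩
    set x : L ⧸ K := QuotientAddGroup.mk ⟨f - X * g, hh⟩ with hx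
    have hdiff : ∃ k ∈ I', f - (X * g + x.out.1) = C c * k := by
      have h1 : (QuotientAddGroup.mk x.out : L ⧸ K) = QuotientAddGroup.mk ⟨f - X * g, hh⟩ := by
        rw [QuotientAddGroup.out_eq']
      rw [QuotientAddGroup.eq, hmemK] at h1
      obtain ⟨k, hk, he⟩ := h1
      refine ⟨k, (mem_low.1 hk).1, ?_⟩
      rw [← mulC_apply, he]
      push_cast; ring
    obtain ⟨k, hk, he⟩ := hdiff
    refine ⟨⟨x, ?_⟩, ?_⟩
    · rw [hJ, unit_J hfI'] at hu
      rw [hx, hψmk]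
      simpa [mul_coeff_zero] using hu.2
    · apply Subtype.ext
      show J c I' (X * g + x.out.1) = I
      rw [← J_congr hk he, ← hJ]

end
end LaurentCount

namespace LaurentCount
open Polynomial
section
variable {R : Type*} [CommRing R] [IsDomain R] [IsPrincipalIdealRing R] [Infinite R]

/-- chosen generator -/
noncomputable def gen (I : Ideal R) : R := Submodule.IsPrincipal.generator I

theorem span_gen (I : Ideal R) : Ideal.span {gen I} = I := Ideal.span_singleton_generator I

theorem gen_mem (I : Ideal R) : gen I ∈ I := Submodule.IsPrincipal.generator_mem I

theorem gen_ne_zero {I : Ideal R} (h : Nat.card (R ⧸ I) ≠ 0) : gen I ≠ 0 := by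
  intro h0
  have h1 := span_gen I
  rw [h0] at h1
  have hI : I = ⊥ := by rw [← h1]; simp
  subst hI
  have : Finite (R ⧸ (⊥ : Ideal R)) := Nat.finite_of_card_ne_zero h
  have : Finite R := Finite.of_equiv _ (RingEquiv.quotientBot R).toEquiv
  exact not_finite R

/-- the set counted by the recursion -/
def S (R : Type*) [CommRing R] (q m n : ℕ) : Set (Ideal R[X]) :=
  {I | Good m I ∧ I.toAddSubgroup.index = q ^ n}

theorem S_zero (q n : ℕ) (hq : 2 ≤ q) : S R q 0 n = if n = 0 then {⊤} else ∅ := by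
  have htop : (⊤ : Ideal R[X]).toAddSubgroup.index = 1 := by simp
  ext I
  have : I ∈ S R q 0 n ↔ I = ⊤ ∧ n = 0 := by
    constructor
    · rintro ⟨⟨⟨f, hf, hfm, hf0⟩, -⟩, h⟩
      rw [hfm.natDegree_eq_zero] at hf0
      subst hf0
      have hI := (Ideal.eq_top_iff_one I).2 hf
      subst hI
      rw [htop] at h
      refine ⟨rfl, ?_⟩
      by_contra hn
      have := Nat.one_lt_pow hn hq
      omega
    · rintro ⟨rfl, rfl⟩
      refine ⟨⟨⟨1, trivial, monic_one, natDegree_one⟩, ⟨1, trivial, by simp⟩, ?_⟩, ?_⟩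
      · rw [htop]; exact one_ne_zero
      · rw [htop]; simp
  rw [this]
  split_ifs with h <;> simp [h]

open Classical in
theorem S_succ (q : ℕ) (hq : 2 ≤ q)
    (hpow : ∀ I : Ideal R, Nat.card (R ⧸ I) ≠ 0 → ∃ t, Nat.card (R ⧸ I) = q ^ t)
    (hpow' : ∀ I : Ideal R[X], I.toAddSubgroup.index ≠ 0 → ∃ t, I.toAddSubgroup.index = q ^ t)
    (Id : ℕ → Finset (Ideal R)) (hId : ∀ t I, I ∈ Id t ↔ Nat.card (R ⧸ I) = q ^ t)
    (m : ℕ) (hS : ∀ n, (S R q m n).Finite) (n : ℕ) :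
    (S R q (m + 1) n).Finite ∧ (S R q (m + 1) n).ncard =
      ∑ t ∈ Finset.range (n + 1), if (m + 1) * t ≤ n then
        ((q ^ t) ^ m * ∑ I ∈ Id t, Nat.card (R ⧸ I)ˣ) * (S R q m (n - (m + 1) * t)).ncard
      else 0 := by
  have hq0 : ∀ t, q ^ t ≠ 0 := fun t => pow_ne_zero _ (by omega)
  let D : Finset (Ideal R × Ideal R[X]) :=
    ((Finset.range (n + 1)).filter (fun t => (m + 1) * t ≤ n)).biUnion
      (fun t => Id t ×ˢ (hS (n - (m + 1) * t)).toFinset)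
  let π : Ideal R[X] → Ideal R × Ideal R[X] := fun I => (lead m I, col (gen (lead m I)) I)
  have hmaps : ∀ I ∈ S R q (m + 1) n, π I ∈ D := by
    rintro I ⟨hI, hidx⟩
    obtain ⟨hc, hgood, heq⟩ := good_col hI (span_gen (lead m I)).symm
    rw [span_gen] at heq
    have h0 : (col (gen (lead m I)) I).toAddSubgroup.index * Nat.card (R ⧸ lead m I) ^ (m + 1) ≠ 0 := by
      rw [← heq]; exact hI.2.2
    obtain ⟨t, ht⟩ := hpow _ (fun h => h0 (by rw [h]; simp))
    obtain ⟨k, hk⟩ := hpow' _ (left_ne_zero_of_mul h0)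
    rw [ht, hk, hidx, ← pow_mul, ← pow_add] at heq
    have hn := Nat.pow_right_injective hq heq
    simp only [D, Finset.mem_biUnion, Finset.mem_filter, Finset.mem_range, Finset.mem_product,
      Set.Finite.mem_toFinset]
    have h1 : t * (m + 1) = (m + 1) * t := mul_comm _ _
    have h2 : t ≤ (m + 1) * t := by nlinarith
    refine ⟨t, ⟨by omega, by omega⟩, (hId _ _).2 ht, hgood, ?_⟩
    rw [hk]; congr 1; omega
  have hfib : ∀ t ∈ (Finset.range (n + 1)).filter (fun t => (m + 1) * t ≤ n),
      ∀ d ∈ Id t ×ˢ (hS (n - (m + 1) * t)).toFinset,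
      {I | I ∈ S R q (m + 1) n ∧ π I = d}.Finite ∧ {I | I ∈ S R q (m + 1) n ∧ π I = d}.ncard =
        (q ^ t) ^ m * Nat.card (R ⧸ d.1)ˣ := by
    rintro t ht ⟨A, I'⟩ hd
    simp only [Finset.mem_filter, Finset.mem_product, Set.Finite.mem_toFinset, hId] at ht hd
    obtain ⟨hA, hI', hidx⟩ := hd
    have hset : {I | I ∈ S R q (m + 1) n ∧ π I = (A, I')} =
        {I | Good (m + 1) I ∧ lead m I = Ideal.span {gen A} ∧ col (gen A) I = I'} := by
      ext I
      simp only [Set.mem_ofPred_eq, π, Prod.mk.injEq, span_gen]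
      constructor
      · rintro ⟨h1, h2, h3⟩
        refine ⟨h1.1, h2, ?_⟩
        rw [← h3, h2]
      · rintro ⟨h1, h2, h3⟩
        refine ⟨⟨h1, ?_⟩, h2, by rw [h2, h3]⟩
        have h2' : lead m I = Ideal.span {gen A} := by rw [h2, span_gen]
        rw [(good_col h1 h2').2.2, h3, span_gen, hA, hidx, ← pow_mul, ← pow_add]
        congr 1
        have h1 : t * (m + 1) = (m + 1) * t := mul_comm _ _
        omega
    have hA0 : Nat.card (R ⧸ A) ≠ 0 := by rw [hA]; exact hq0 t
    have hcard := fiber_card (gen_ne_zero hA0) hI' (by rw [span_gen]; exact hA0)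
    rw [span_gen] at hcard
    rw [hset]
    have hcard' : Nat.card {I | Good (m + 1) I ∧ lead m I = Ideal.span {gen A} ∧
        col (gen A) I = I'} = (q ^ t) ^ m * Nat.card (R ⧸ A)ˣ := by
      rw [← hA, ← hcard, span_gen]; rfl
    refine ⟨?_, hcard'⟩
    have : Finite (R ⧸ A) := Nat.finite_of_card_ne_zero hA0
    have := Nat.finite_of_card_ne_zero (hcard'.trans_ne
      (mul_ne_zero (pow_ne_zero _ (hq0 t)) Nat.card_pos.ne'))
    exact this
  have hfinite : (S R q (m + 1) n).Finite := by
    have : S R q (m + 1) n ⊆ ⋃ d ∈ D, {I | I ∈ S R q (m + 1) n ∧ π I = d} := by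
      intro I hI
      simp only [Set.mem_iUnion]
      exact ⟨π I, hmaps I hI, hI, rfl⟩
    refine Set.Finite.subset (Set.Finite.biUnion D.finite_toSet ?_) this
    intro d hd
    obtain ⟨t, ht, hd⟩ := Finset.mem_biUnion.1 hd
    exact (hfib t ht d hd).1
  refine ⟨hfinite, ?_⟩
  rw [Set.ncard_eq_toFinset_card _ hfinite,
    Finset.card_eq_sum_card_fiberwise (f := π) (t := D)
      (fun I hI => hmaps I (by simpa using hI))]
  rw [← Finset.sum_filter, Finset.sum_biUnion]
  · refine Finset.sum_congr rfl fun t ht => ?_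
    have : ∀ d ∈ Id t ×ˢ (hS (n - (m + 1) * t)).toFinset,
        (hfinite.toFinset.filter (fun a => π a = d)).card = (q ^ t) ^ m * Nat.card (R ⧸ d.1)ˣ := by
      intro d hd
      rw [← (hfib t ht d hd).2, ← Set.ncard_coe_finset]
      congr 1
      ext I; simp
    rw [Finset.sum_congr rfl this, Finset.sum_product]
    rw [Set.ncard_eq_toFinset_card _ (hS _), Finset.mul_sum, Finset.sum_mul]
    refine Finset.sum_congr rfl fun A _ => ?_
    exact (Finset.sum_const ((q ^ t) ^ m * Nat.card (R ⧸ A)ˣ)).trans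
      (by rw [smul_eq_mul, mul_comm])
  · intro t _ t' _ hne
    simp only [Function.onFun]
    rw [Finset.disjoint_left]
    rintro ⟨A, I'⟩ h1 h2
    simp only [Finset.mem_product, hId] at h1 h2
    exact hne (Nat.pow_right_injective hq (h1.1.symm.trans h2.1))

theorem S_finite (q : ℕ) (hq : 2 ≤ q)
    (hpow : ∀ I : Ideal R, Nat.card (R ⧸ I) ≠ 0 → ∃ t, Nat.card (R ⧸ I) = q ^ t)
    (hpow' : ∀ I : Ideal R[X], I.toAddSubgroup.index ≠ 0 → ∃ t, I.toAddSubgroup.index = q ^ t)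
    (Id : ℕ → Finset (Ideal R)) (hId : ∀ t I, I ∈ Id t ↔ Nat.card (R ⧸ I) = q ^ t)
    (m : ℕ) : ∀ n, (S R q m n).Finite := by
  induction m with
  | zero => intro n; rw [S_zero q n hq]; split_ifs <;> simp
  | succ m ih => intro n; exact (S_succ q hq hpow hpow' Id hId m ih n).1

end

section gauss
variable {R : Type*} [CommRing R] [IsDomain R] [IsPrincipalIdealRing R] [Infinite R]

theorem card_mul {a b : R} (ha : a ≠ 0) : Nat.card (R ⧸ Ideal.span {a * b}) =
    Nat.card (R ⧸ Ideal.span {a}) * Nat.card (R ⧸ Ideal.span {b}) := by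
  have hinj : Function.Injective (AddMonoidHom.mulLeft a) := fun x y h => mul_left_cancel₀ ha h
  have h1 : ∀ I : Ideal R, Nat.card (R ⧸ I) = I.toAddSubgroup.index := fun I => rfl
  have h := AddSubgroup.index_map_of_injective (Ideal.span {b}).toAddSubgroup hinj
  have e1 : (Ideal.span {a * b}).toAddSubgroup =
      (Ideal.span {b}).toAddSubgroup.map (AddMonoidHom.mulLeft a) := by
    ext x
    simp only [Submodule.mem_toAddSubgroup, Ideal.mem_span_singleton', AddSubgroup.mem_map]
    constructor
    · rintro ⟨r, rfl⟩
      exact ⟨r * b, ⟨r, rfl⟩, by simp; ring⟩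
    · rintro ⟨_, ⟨r, rfl⟩, rfl⟩
      exact ⟨r, by simp; ring⟩
  have e2 : (Ideal.span {a}).toAddSubgroup = (AddMonoidHom.mulLeft a).range := by
    ext x
    simp only [Submodule.mem_toAddSubgroup, Ideal.mem_span_singleton', AddMonoidHom.mem_range]
    constructor
    · rintro ⟨r, rfl⟩
      exact ⟨r, by simp; ring⟩
    · rintro ⟨r, rfl⟩
      exact ⟨r, by simp; ring⟩
  rw [h1, h1, h1, e1, e2, h]
  exact mul_comm _ _

theorem card_ann (A D : Ideal R) (hA : Nat.card (R ⧸ A) ≠ 0) (hAD : A ≤ D) :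
    Nat.card {x : R ⧸ A // Ideal.torsionOf R (R ⧸ A) x = D} = Nat.card (R ⧸ D)ˣ := by
  obtain ⟨e, he⟩ : gen D ∣ gen A := by
    rw [← Ideal.mem_span_singleton, span_gen]
    exact hAD (gen_mem A)
  have hA0 := gen_ne_zero hA
  have he0 : e ≠ 0 := by rintro rfl; simp at he; exact hA0 he
  have hD0 : gen D ≠ 0 := by intro h; rw [h, zero_mul] at he; exact hA0 he
  have hmemA : ∀ x, x ∈ A ↔ gen A ∣ x := fun x => by
    rw [← Ideal.mem_span_singleton, span_gen]
  have hmemD : ∀ x, x ∈ D ↔ gen D ∣ x := fun x => by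
    rw [← Ideal.mem_span_singleton, span_gen]
  have key : ∀ r, r * e ∈ A ↔ r ∈ D := by
    intro r
    rw [hmemA, hmemD, he, mul_dvd_mul_iff_right he0]
  have hfinD : Finite (R ⧸ D) := by
    have : Finite (R ⧸ A) := Nat.finite_of_card_ne_zero hA
    exact Finite.of_surjective _ (Ideal.Quotient.factor_surjective hAD)
  have htor : ∀ x r : R, r ∈ Ideal.torsionOf R (R ⧸ A) (Ideal.Quotient.mk A x) ↔ r * x ∈ A := by
    intro x r
    rw [Ideal.mem_torsionOf_iff, ← Ideal.Quotient.eq_zero_iff_mem, map_mul]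
    rfl
  have hunit : ∀ b : R, IsUnit (Ideal.Quotient.mk D b) ↔
      Ideal.torsionOf R (R ⧸ A) (Ideal.Quotient.mk A (b * e)) = D := by
    intro b
    have h1 : Ideal.torsionOf R (R ⧸ A) (Ideal.Quotient.mk A (b * e)) = D ↔
        ∀ r, r * b ∈ D → r ∈ D := by
      constructor
      · intro h r hr
        rw [← h, htor, ← mul_assoc, key]; exact hr
      · intro h
        ext r
        rw [htor, ← mul_assoc, key]
        exact ⟨h r, fun hr => D.mul_mem_right _ hr⟩
    rw [h1]
    constructor
    · intro hu r hr
      rw [← Ideal.Quotient.eq_zero_iff_mem, map_mul, hu.mul_left_eq_zero] at hr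
      exact Ideal.Quotient.eq_zero_iff_mem.1 hr
    · intro h
      have hinj : Function.Injective (fun x : R ⧸ D => x * Ideal.Quotient.mk D b) := by
        intro x y hxy
        obtain ⟨x, rfl⟩ := Ideal.Quotient.mk_surjective x
        obtain ⟨y, rfl⟩ := Ideal.Quotient.mk_surjective y
        simp only [← map_mul] at hxy
        rw [Ideal.Quotient.eq, ← sub_mul] at hxy
        exact Ideal.Quotient.eq.2 (h _ hxy)
      obtain ⟨y, hy⟩ := Finite.surjective_of_injective hinj 1
      exact IsUnit.of_mul_eq_one_right y hy
  symm
  have hout : ∀ x : R ⧸ D, Ideal.Quotient.mk D x.out = x := fun x => Ideal.Quotient.mk_out x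
  refine Nat.card_congr (Equiv.ofBijective
    (fun u : (R ⧸ D)ˣ => ⟨Ideal.Quotient.mk A ((u : R ⧸ D).out * e), ?_⟩) ⟨?_, ?_⟩)
  · rw [← hunit, hout]; exact u.isUnit
  · intro u v huv
    have huv := congrArg Subtype.val huv
    simp only at huv
    rw [Ideal.Quotient.eq, ← sub_mul, key, ← Ideal.Quotient.eq, hout, hout] at huv
    exact Units.ext huv
  · rintro ⟨x, hx⟩
    obtain ⟨x, rfl⟩ := Ideal.Quotient.mk_surjective x
    have h1 : gen D * x ∈ A := by
      rw [← htor, hx, hmemD]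
    rw [hmemA, he, mul_dvd_mul_iff_left hD0] at h1
    obtain ⟨b, rfl⟩ := h1
    rw [mul_comm e b] at hx
    have hu := (hunit b).2 hx
    refine ⟨hu.unit, ?_⟩
    apply Subtype.ext
    simp only
    rw [Ideal.Quotient.eq, mul_comm e b, ← sub_mul, key, ← Ideal.Quotient.eq, hout]
    rfl

open Classical in
theorem gauss_sum (q : ℕ) (hq : 2 ≤ q)
    (hpow : ∀ I : Ideal R, Nat.card (R ⧸ I) ≠ 0 → ∃ t, Nat.card (R ⧸ I) = q ^ t)
    (Id : ℕ → Finset (Ideal R)) (hId : ∀ t I, I ∈ Id t ↔ Nat.card (R ⧸ I) = q ^ t) (t : ℕ) :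
    q ^ t * (Id t).card = ∑ s ∈ Finset.range (t + 1),
      (∑ I ∈ Id s, Nat.card (R ⧸ I)ˣ) * (Id (t - s)).card := by
  have hq0 : ∀ t, q ^ t ≠ 0 := fun t => pow_ne_zero _ (by omega)
  have hle : ∀ s A D, A ∈ Id t → D ∈ Id s → A ≤ D → s ≤ t := by
    intro s A D hA hD hAD
    rw [hId] at hA hD
    have : Finite (R ⧸ A) := Nat.finite_of_card_ne_zero (hA.trans_ne (hq0 _))
    have := Nat.card_le_card_of_surjective _ (Ideal.Quotient.factor_surjective hAD)
    rw [hA, hD] at this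
    exact (Nat.pow_le_pow_iff_right hq).1 this
  have hdisj : ∀ T : Finset ℕ, (T : Set ℕ).PairwiseDisjoint Id := by
    intro T s _ s' _ hne
    simp only [Function.onFun]
    rw [Finset.disjoint_left]
    intro A h1 h2
    rw [hId] at h1 h2
    exact hne (Nat.pow_right_injective hq (h1.symm.trans h2))
  have h1 : ∀ A ∈ Id t, q ^ t = ∑ s ∈ Finset.range (t + 1), ∑ D ∈ Id s,
      if A ≤ D then Nat.card (R ⧸ D)ˣ else 0 := by
    intro A hA
    have hA' := (hId _ _).1 hA
    have hA0 := hA'.trans_ne (hq0 _)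
    have hfin : Finite (R ⧸ A) := Nat.finite_of_card_ne_zero hA0
    let _ : Fintype (R ⧸ A) := Fintype.ofFinite _
    have hleann : ∀ x, A ≤ Ideal.torsionOf R (R ⧸ A) x := by
      intro x r hr
      obtain ⟨x, rfl⟩ := Ideal.Quotient.mk_surjective x
      rw [Ideal.mem_torsionOf_iff]
      have : r • Ideal.Quotient.mk A x = Ideal.Quotient.mk A (r * x) := rfl
      rw [this, Ideal.Quotient.eq_zero_iff_mem]
      exact A.mul_mem_right _ hr
    rw [← Finset.sum_biUnion (hdisj _), ← hA', Nat.card_eq_fintype_card, ← Finset.card_univ,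
      Finset.card_eq_sum_card_fiberwise (f := fun x => Ideal.torsionOf R (R ⧸ A) x)
        (t := (Finset.range (t + 1)).biUnion Id)]
    · refine Finset.sum_congr rfl fun D _ => ?_
      split_ifs with hAD
      · rw [← card_ann A D hA0 hAD, Nat.card_eq_fintype_card, Fintype.card_subtype]
      · rw [Finset.card_eq_zero, Finset.filter_eq_empty_iff]
        rintro x _ rfl
        exact hAD (hleann x)
    · intro x _
      have hfin' : Finite (R ⧸ Ideal.torsionOf R (R ⧸ A) x) :=
        Finite.of_surjective _ (Ideal.Quotient.factor_surjective (hleann x))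
      obtain ⟨s, hs⟩ := hpow (Ideal.torsionOf R (R ⧸ A) x) Nat.card_pos.ne'
      have hs' := (hId _ _).2 hs
      simp only [Finset.coe_biUnion, Set.mem_iUnion]
      have := hle s A _ hA hs' (hleann x)
      exact ⟨s, by simp; omega, hs'⟩
  have h2 : ∀ s ∈ Finset.range (t + 1), ∀ D ∈ Id s,
      ((Id t).filter (fun A => A ≤ D)).card = (Id (t - s)).card := by
    intro s hs D hD
    have hst : s ≤ t := by simp at hs; omega
    rw [hId] at hD
    have hD0 := gen_ne_zero (hD.trans_ne (hq0 _))
    symm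
    refine Finset.card_bij (fun E _ => Ideal.span {gen D * gen E}) ?_ ?_ ?_
    · intro E hE
      rw [hId] at hE
      rw [Finset.mem_filter, hId, card_mul hD0, span_gen, span_gen, hD, hE, ← pow_add]
      refine ⟨by congr 1; omega, ?_⟩
      conv_rhs => rw [← span_gen D]
      rw [Ideal.span_singleton_le_span_singleton]
      exact dvd_mul_right _ _
    · intro E _ E' _ h
      rw [Ideal.span_singleton_eq_span_singleton] at h
      rw [← span_gen E, ← span_gen E', Ideal.span_singleton_eq_span_singleton]
      exact (Associated.of_mul_left h (Associated.refl _) hD0)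
    · intro A hA
      rw [Finset.mem_filter, hId] at hA
      obtain ⟨e, he⟩ : gen D ∣ gen A := by
        rw [← Ideal.mem_span_singleton, span_gen]
        exact hA.2 (gen_mem A)
      have hA2 : A = Ideal.span {gen D * e} := by rw [← he, span_gen]
      refine ⟨Ideal.span {e}, ?_, ?_⟩
      · rw [hId]
        have := hA.1
        rw [hA2, card_mul hD0, span_gen, hD] at this
        have h3 : q ^ t = q ^ s * q ^ (t - s) := by rw [← pow_add]; congr 1; omega
        rw [h3] at this
        exact Nat.eq_of_mul_eq_mul_left (Nat.pos_of_ne_zero (hq0 _)) this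
      · rw [hA2, Ideal.span_singleton_eq_span_singleton]
        refine Associated.mul_left _ ?_
        rw [← Ideal.span_singleton_eq_span_singleton, span_gen]
  calc q ^ t * (Id t).card = ∑ A ∈ Id t, q ^ t := by simp [mul_comm]
    _ = ∑ A ∈ Id t, ∑ s ∈ Finset.range (t + 1), ∑ D ∈ Id s,
      (if A ≤ D then Nat.card (R ⧸ D)ˣ else 0) := Finset.sum_congr rfl h1
    _ = ∑ s ∈ Finset.range (t + 1), ∑ D ∈ Id s, ∑ A ∈ Id t,
      (if A ≤ D then Nat.card (R ⧸ D)ˣ else 0) := by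
        rw [Finset.sum_comm]
        exact Finset.sum_congr rfl fun s _ => Finset.sum_comm
    _ = _ := by
      refine Finset.sum_congr rfl fun s hs => ?_
      rw [Finset.sum_mul]
      refine Finset.sum_congr rfl fun D hD => ?_
      rw [← Finset.sum_filter, Finset.sum_const, h2 s hs D hD, smul_eq_mul, mul_comm]

end gauss

theorem N_formula (q : ℚ) (M N : ℕ → ℚ) (hM0 : M 0 = 1)
    (hM : ∀ t, M (t + 1) = (q - 1) * q ^ t)
    (hG : ∀ t, q ^ t * M t = ∑ s ∈ Finset.range (t + 1), N s * M (t - s)) (t : ℕ) :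
    N 0 = 1 ∧ N (t + 1) * (q ^ 2 - 1) = (q - 1) ^ 2 * (q ^ (2 * (t + 1)) - 1) := by
  have h0 : N 0 = 1 := by
    have := hG 0
    simpa [hM0] using this.symm
  refine ⟨h0, ?_⟩
  have hstep : ∀ t, q ^ (t + 1) * M (t + 1) - q * (q ^ t * M t) = N (t + 1) - N t := by
    intro t
    rw [hG (t + 1), hG t, Finset.sum_range_succ, Finset.sum_range_succ, Finset.sum_range_succ,
      mul_add, Finset.mul_sum]
    have : ∑ s ∈ Finset.range t, N s * M (t + 1 - s) =
        ∑ s ∈ Finset.range t, q * (N s * M (t - s)) := by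
      refine Finset.sum_congr rfl fun s hs => ?_
      have hs : s < t := by simpa using hs
      obtain ⟨k, hk⟩ : ∃ k, t - s = k + 1 := ⟨t - s - 1, by omega⟩
      rw [show t + 1 - s = (k + 1) + 1 by omega, hk, hM, hM]
      ring
    rw [this, show t + 1 - t = 0 + 1 by omega, Nat.sub_self, Nat.sub_self, hM, hM0]
    ring
  induction t with
  | zero =>
    have := hstep 0
    rw [hM, hM0, h0] at this
    have h : N (0 + 1) = (q - 1) ^ 2 := by linear_combination -this
    rw [h]
  | succ t ih =>
    have := hstep (t + 1)
    rw [hM, hM] at this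
    have h : N (t + 1 + 1) = N (t + 1) + (q - 1) ^ 2 * q ^ (2 * (t + 1)) := by
      linear_combination -this
    rw [h, add_mul, ih]; ring

end LaurentCount

namespace LaurentCount
open Polynomial
open scoped LaurentPolynomial
section loc
variable {S A : Type*} [CommRing S] [CommRing A] [Algebra S A]

theorem loc_card_eq (y : S) [IsLocalization.Away y A] (J : Ideal A) (h : ∃ z, 1 - y * z ∈ J.comap (algebraMap S A)) :
    Nat.card (S ⧸ J.comap (algebraMap S A)) = Nat.card (A ⧸ J) := by
  obtain ⟨z, hz⟩ := h
  refine Nat.card_congr (Equiv.ofBijective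
    (Ideal.quotientMap J (algebraMap S A) le_rfl) ⟨Ideal.quotientMap_injective, ?_⟩)
  intro a
  obtain ⟨a, rfl⟩ := Ideal.Quotient.mk_surjective a
  obtain ⟨s, ⟨_, k, rfl⟩, rfl⟩ := IsLocalization.exists_mk'_eq (Submonoid.powers y) a
  refine ⟨Ideal.Quotient.mk _ (z ^ k * s), ?_⟩
  rw [Ideal.quotientMap_mk, Ideal.Quotient.eq]
  have hu : IsUnit (algebraMap S A (y ^ k)) :=
    IsLocalization.map_units A (⟨y ^ k, k, rfl⟩ : Submonoid.powers y)
  rw [← Ideal.unit_mul_mem_iff_mem J hu, mul_sub]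
  have h2 : algebraMap S A (y ^ k) * IsLocalization.mk' A s (⟨y ^ k, k, rfl⟩ : Submonoid.powers y)
      = algebraMap S A s := IsLocalization.mk'_spec' A s (⟨y ^ k, k, rfl⟩ : Submonoid.powers y)
  rw [h2, ← map_mul, ← map_sub]
  have h3 : y ^ k * (z ^ k * s) - s = -(s * (1 - (y * z) ^ k)) := by ring
  rw [h3]
  change _ ∈ J.comap (algebraMap S A)
  rw [neg_mem_iff]
  refine Ideal.mul_mem_left _ _ ?_
  have h4 : (1 - y * z) ∣ 1 - (y * z) ^ k := by
    simpa using sub_dvd_pow_sub_pow (1 : S) (y * z) k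
  exact Ideal.mem_of_dvd _ h4 hz

theorem loc_exists (y : S) [IsLocalization.Away y A] (J : Ideal A) (h : Nat.card (A ⧸ J) ≠ 0) :
    ∃ z, 1 - y * z ∈ J.comap (algebraMap S A) := by
  have : Finite (A ⧸ J) := Nat.finite_of_card_ne_zero h
  have hfin : Finite (S ⧸ J.comap (algebraMap S A)) :=
    Finite.of_injective (Ideal.quotientMap J (algebraMap S A) le_rfl) Ideal.quotientMap_injective
  have hu : IsUnit (algebraMap S A y) := IsLocalization.Away.algebraMap_isUnit y
  have hinj : Function.Injective (fun x : S ⧸ J.comap (algebraMap S A) =>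
      Ideal.Quotient.mk _ y * x) := by
    intro u v huv
    obtain ⟨u, rfl⟩ := Ideal.Quotient.mk_surjective u
    obtain ⟨v, rfl⟩ := Ideal.Quotient.mk_surjective v
    simp only [← map_mul] at huv
    rw [Ideal.Quotient.eq, ← mul_sub, Ideal.mem_comap, map_mul,
      Ideal.unit_mul_mem_iff_mem J hu] at huv
    exact Ideal.Quotient.eq.2 huv
  obtain ⟨z, hz⟩ := Finite.surjective_of_injective hinj 1
  obtain ⟨z, rfl⟩ := Ideal.Quotient.mk_surjective z
  refine ⟨z, ?_⟩
  rw [← Ideal.Quotient.eq, map_one, ← hz, map_mul]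

theorem loc_comap_map (y : S) [IsLocalization.Away y A] (I : Ideal S) (h : ∃ z, 1 - y * z ∈ I) :
    (I.map (algebraMap S A)).comap (algebraMap S A) = I := by
  refine le_antisymm ?_ Ideal.le_comap_map
  intro x hx
  rw [Ideal.mem_comap, IsLocalization.algebraMap_mem_map_algebraMap_iff (Submonoid.powers y)] at hx
  obtain ⟨_, ⟨k, rfl⟩, hk⟩ := hx
  obtain ⟨z, hz⟩ := h
  have h4 : (1 - y * z) ∣ 1 - (y * z) ^ k := by
    simpa using sub_dvd_pow_sub_pow (1 : S) (y * z) k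
  have h5 := I.mul_mem_left x (Ideal.mem_of_dvd _ h4 hz)
  have h6 := I.mul_mem_left (z ^ k) hk
  have : x = x * (1 - (y * z) ^ k) + z ^ k * (y ^ k * x) := by ring
  rw [this]
  exact I.add_mem h5 h6

theorem loc_map_comap (y : S) [IsLocalization.Away y A] (J : Ideal A) : (J.comap (algebraMap S A)).map (algebraMap S A) = J :=
  IsLocalization.map_under (Submonoid.powers y) A J

/-- finite index ideals of a localization -/
theorem loc_equiv (y : S) [IsLocalization.Away y A] (N : ℕ) (hN : N ≠ 0) :
    Nonempty ({J : Ideal A // Nat.card (A ⧸ J) = N} ≃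
      {I : Ideal S // (∃ z, 1 - y * z ∈ I) ∧ Nat.card (S ⧸ I) = N}) := by
  refine ⟨Equiv.ofBijective (fun J => ⟨J.1.comap (algebraMap S A), ?_, ?_⟩) ⟨?_, ?_⟩⟩
  · exact loc_exists y J.1 (by rw [J.2]; exact hN)
  · rw [loc_card_eq y J.1 (loc_exists y J.1 (by rw [J.2]; exact hN)), J.2]
  · intro J J' h
    have h := congrArg Subtype.val h
    simp only at h
    apply Subtype.ext
    rw [← loc_map_comap (S := S) y J.1, h, loc_map_comap y]
  · rintro ⟨I, hz, hI⟩
    have h1 := loc_comap_map (A := A) y I hz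
    refine ⟨⟨I.map (algebraMap S A), ?_⟩, ?_⟩
    · rw [← loc_card_eq y _ (by rw [h1]; exact hz), h1, hI]
    · apply Subtype.ext
      exact h1

theorem loc_pir (y : S) [IsLocalization.Away y A]
    [IsPrincipalIdealRing S] : IsPrincipalIdealRing A := by
  refine ⟨fun J => ?_⟩
  rw [← loc_map_comap (S := S) y J]
  obtain ⟨g, hg⟩ := (IsPrincipalIdealRing.principal (J.comap (algebraMap S A))).principal
  rw [hg, ← Ideal.span, Ideal.map_span, Set.image_singleton]
  exact ⟨_, rfl⟩

end loc

section field
variable {F : Type*} [Field F] [Finite F]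

instance : IsPrincipalIdealRing F[T;T⁻¹] := loc_pir (S := F[X]) X

instance : Infinite F[T;T⁻¹] :=
  Infinite.of_injective _ (Polynomial.toLaurent_injective (R := F))

example : IsDomain F[T;T⁻¹] := inferInstance

theorem card_pow {A : Type*} [CommRing A] [Algebra F A] (I : Ideal A) (h : Nat.card (A ⧸ I) ≠ 0) :
    ∃ t, Nat.card (A ⧸ I) = Nat.card F ^ t := by
  have : Finite (A ⧸ I) := Nat.finite_of_card_ne_zero h
  exact ⟨_, Module.natCard_eq_pow_finrank (K := F)⟩

theorem card_iff {A : Type*} [CommRing A] [Algebra F A] (I : Ideal A) (n : ℕ) (hn : 1 ≤ n) :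
    Module.finrank F (A ⧸ I) = n ↔ Nat.card (A ⧸ I) = Nat.card F ^ n := by
  constructor
  · intro h
    have : Module.Finite F (A ⧸ I) := Module.finite_of_finrank_pos (by omega)
    rw [Module.natCard_eq_pow_finrank (K := F), h]
  · intro h
    have h0 : Nat.card (A ⧸ I) ≠ 0 := by rw [h]; exact pow_ne_zero _ Nat.card_pos.ne'
    have : Finite (A ⧸ I) := Nat.finite_of_card_ne_zero h0
    rw [Module.natCard_eq_pow_finrank (K := F)] at h
    exact Nat.pow_right_injective (Finite.one_lt_card) h

theorem card_span (f : F[X]) (hf : f ≠ 0) :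
    Nat.card (F[X] ⧸ Ideal.span {f}) = Nat.card F ^ f.natDegree := by
  have : Module.Finite F (F[X] ⧸ Ideal.span {f}) := by
    exact (AdjoinRoot.powerBasis hf).finite
  rw [Module.natCard_eq_pow_finrank (K := F), finrank_quotient_span_eq_natDegree]

/-- ideals of `F[X]` prime to `X` -/
theorem poly_ideal_count (t : ℕ) :
    Nat.card {I : Ideal F[X] // (∃ z, 1 - X * z ∈ I) ∧ Nat.card (F[X] ⧸ I) = Nat.card F ^ t} =
    Nat.card {f : F[X] // f.Monic ∧ f.natDegree = t ∧ f.coeff 0 ≠ 0} := by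
  have hX : ∀ f : F[X], (∃ z, 1 - X * z ∈ Ideal.span {f}) ↔ f.coeff 0 ≠ 0 := by
    intro f
    constructor
    · rintro ⟨z, hz⟩ h0
      rw [Ideal.mem_span_singleton] at hz
      obtain ⟨g, hg⟩ := hz
      have := congrArg (fun p => p.coeff 0) hg
      simp [mul_coeff_zero, h0] at this
    · intro h0
      refine ⟨-(C (f.coeff 0)⁻¹ * f.divX), ?_⟩
      rw [Ideal.mem_span_singleton]
      refine ⟨C (f.coeff 0)⁻¹, ?_⟩
      have h1 := f.divX_mul_X_add
      have h2 : C (f.coeff 0) * C (f.coeff 0)⁻¹ = 1 := by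
        rw [← C_mul, mul_inv_cancel₀ h0, C_1]
      linear_combination C (f.coeff 0)⁻¹ * h1 - h2
  symm
  refine Nat.card_congr (Equiv.ofBijective (fun f => ⟨Ideal.span {f.1}, (hX f.1).2 f.2.2.2, ?_⟩)
    ⟨?_, ?_⟩)
  · rw [card_span f.1 f.2.1.ne_zero, f.2.2.1]
  · intro f g h
    have h := congrArg Subtype.val h
    simp only [Ideal.span_singleton_eq_span_singleton] at h
    exact Subtype.ext (eq_of_monic_of_associated f.2.1 g.2.1 h)
  · rintro ⟨I, hz, hI⟩
    have hg := span_gen I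
    have hg0 : gen I ≠ 0 := gen_ne_zero (by rw [hI]; exact pow_ne_zero _ Nat.card_pos.ne')
    have hm := monic_mul_leadingCoeff_inv hg0
    have hu : IsUnit (C (gen I).leadingCoeff⁻¹) :=
      isUnit_C.2 (IsUnit.mk0 _ (inv_ne_zero (leadingCoeff_ne_zero.2 hg0)))
    have hs : Ideal.span {gen I * C (gen I).leadingCoeff⁻¹} = I := by
      rw [Ideal.span_singleton_mul_right_unit hu, hg]
    refine ⟨⟨gen I * C (gen I).leadingCoeff⁻¹, hm, ?_, ?_⟩, Subtype.ext hs⟩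
    · have h1 := card_span _ hm.ne_zero
      rw [hs, hI] at h1
      exact (Nat.pow_right_injective (Finite.one_lt_card) h1).symm
    · rw [← hX, hs]; exact hz

theorem monic_count (t : ℕ) :
    Nat.card {f : F[X] // f.Monic ∧ f.natDegree = t ∧ f.coeff 0 ≠ 0} =
    if t = 0 then 1 else (Nat.card F - 1) * Nat.card F ^ (t - 1) := by
  cases t with
  | zero =>
    rw [if_pos rfl, Nat.card_eq_one_iff_unique]
    refine ⟨⟨fun f g => Subtype.ext ?_⟩, ⟨1, monic_one, natDegree_one, by simp⟩⟩
    rw [(f.2.1.natDegree_eq_zero).1 f.2.2.1, (g.2.1.natDegree_eq_zero).1 g.2.2.1]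
  | succ k =>
    rw [if_neg (Nat.succ_ne_zero k), Nat.add_sub_cancel]
    let e : {p : F[X] // p.Monic ∧ p.natDegree = k + 1} ≃ F × (Fin k → F) :=
      (monicEquivDegreeLT (k + 1)).trans
        ((degreeLTEquiv F (k + 1)).toEquiv.trans (Fin.consEquiv (fun _ => F)).symm)
    have he : ∀ p, (e p).1 = p.1.coeff 0 := by
      intro p
      change p.1.eraseLead.coeff 0 = _
      rw [eraseLead_coeff_of_ne]
      rw [p.2.2]; omega
    have h1 : Nat.card {f : F[X] // f.Monic ∧ f.natDegree = k + 1 ∧ f.coeff 0 ≠ 0} =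
        Nat.card {p : {p : F[X] // p.Monic ∧ p.natDegree = k + 1} // p.1.coeff 0 ≠ 0} := by
      refine Nat.card_congr ⟨fun f => ⟨⟨f.1, f.2.1, f.2.2.1⟩, f.2.2.2⟩,
        fun f => ⟨f.1.1, f.1.2.1, f.1.2.2, f.2⟩, fun _ => rfl, fun _ => rfl⟩
    have h2 : Nat.card {p : {p : F[X] // p.Monic ∧ p.natDegree = k + 1} // p.1.coeff 0 ≠ 0} =
        Nat.card {v : F × (Fin k → F) // v.1 ≠ 0} :=
      Nat.card_congr (e.subtypeEquiv fun p => by rw [he])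
    have h3 : Nat.card {v : F × (Fin k → F) // v.1 ≠ 0} = Nat.card (Fˣ × (Fin k → F)) :=
      Nat.card_congr ((Equiv.prodSubtypeFstEquivSubtypeProd (p := fun a : F => a ≠ 0)).trans
        (Equiv.prodCongr unitsEquivNeZero.symm (Equiv.refl _)))
    rw [h1, h2, h3, Nat.card_prod, Nat.card_units, Nat.card_fun, Nat.card_fin]

theorem ideal_count (t : ℕ) :
    Nat.card {I : Ideal F[T;T⁻¹] // Nat.card (F[T;T⁻¹] ⧸ I) = Nat.card F ^ t} =
    if t = 0 then 1 else (Nat.card F - 1) * Nat.card F ^ (t - 1) := by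
  obtain ⟨e⟩ := loc_equiv (S := F[X]) (A := F[T;T⁻¹]) X (Nat.card F ^ t)
    (pow_ne_zero _ Nat.card_pos.ne')
  rw [Nat.card_congr e, poly_ideal_count, monic_count]

theorem ideal_finite (t : ℕ) :
    {I : Ideal F[T;T⁻¹] | Nat.card (F[T;T⁻¹] ⧸ I) = Nat.card F ^ t}.Finite := by
  have h1 : 1 < Nat.card F := Finite.one_lt_card
  refine Nat.finite_of_card_ne_zero ((ideal_count t).trans_ne ?_)
  split_ifs
  · exact one_ne_zero
  · exact mul_ne_zero (by omega) (pow_ne_zero _ (by omega))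

theorem good_of_card {R : Type*} [CommRing R] [Algebra F R] (I : Ideal R[X]) (n : ℕ)
    (h : Nat.card (R[X] ⧸ I) = Nat.card F ^ n) : ∃ f ∈ I, f.Monic ∧ f.natDegree = n := by
  have h0 : Nat.card (R[X] ⧸ I) ≠ 0 := by rw [h]; exact pow_ne_zero _ Nat.card_pos.ne'
  have : Finite (R[X] ⧸ I) := Nat.finite_of_card_ne_zero h0
  cases subsingleton_or_nontrivial R with
  | inl hs =>
    have h2 : Nat.card (R[X] ⧸ I) = 1 := by
      have : Subsingleton (R[X] ⧸ I) := Ideal.Quotient.mk_surjective.subsingleton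
      exact Nat.card_unique
    have hn : n = 0 := by
      by_contra hn
      have := Nat.one_lt_pow hn (Finite.one_lt_card (α := F))
      omega
    exact ⟨0, I.zero_mem, Subsingleton.elim _ _, by simp [hn]⟩
  | inr hs =>
    rw [Module.natCard_eq_pow_finrank (K := F)] at h
    have hfr := Nat.pow_right_injective (Finite.one_lt_card) h
    let x := Ideal.Quotient.mk I X
    have hle : (minpoly F x).natDegree ≤ n := by rw [← hfr]; exact minpoly.natDegree_le x
    have hmon : (minpoly F x).Monic := minpoly.monic (Algebra.IsIntegral.isIntegral x)
    have hmon' : ((minpoly F x).map (algebraMap F R)).Monic := hmon.map _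
    refine ⟨(minpoly F x).map (algebraMap F R) * X ^ (n - (minpoly F x).natDegree), ?_,
      hmon'.mul (monic_X_pow _), ?_⟩
    · refine I.mul_mem_right _ ?_
      rw [← Ideal.Quotient.eq_zero_iff_mem]
      have h1 := minpoly.aeval F x
      have h2 : aeval (X : R[X]) (minpoly F x) = (minpoly F x).map (algebraMap F R) :=
        aeval_X_left_eq_map _
      rw [← h2]
      have h3 := Polynomial.aeval_algHom_apply (Ideal.Quotient.mkₐ F I) X (minpoly F x)
      exact h3.symm.trans h1
    · rw [hmon'.natDegree_mul (monic_X_pow _), natDegree_X_pow, hmon.natDegree_map]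
      omega

end field
end LaurentCount

namespace LaurentCount
open Polynomial
open scoped LaurentPolynomial

theorem card_ideals_congr {A B : Type*} [CommRing A] [CommRing B] (e : A ≃+* B) (N : ℕ) :
    Nat.card {I : Ideal A // Nat.card (A ⧸ I) = N} =
      Nat.card {I : Ideal B // Nat.card (B ⧸ I) = N} := by
  refine Nat.card_congr (e.idealComapOrderIso.symm.toEquiv.subtypeEquiv fun I => ?_)
  have : Nat.card (A ⧸ I) = Nat.card (B ⧸ e.idealComapOrderIso.symm I) := by
    refine Nat.card_congr (Ideal.quotientEquiv I _ e ?_).toEquiv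
    rfl
  rw [this]; rfl

theorem count_eq {F : Type*} [Field F] [Finite F] (n : ℕ) (hn : 1 ≤ n) :
    Nat.card {I : Ideal (AddMonoidAlgebra F (ℤ × ℤ)) //
        Module.finrank F (AddMonoidAlgebra F (ℤ × ℤ) ⧸ I) = n} =
      (S F[T;T⁻¹] (Nat.card F) n n).ncard := by
  have hq0 : Nat.card F ^ n ≠ 0 := pow_ne_zero _ Nat.card_pos.ne'
  have h1 : Nat.card {I : Ideal (AddMonoidAlgebra F (ℤ × ℤ)) //
        Module.finrank F (AddMonoidAlgebra F (ℤ × ℤ) ⧸ I) = n} =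
      Nat.card {I : Ideal (AddMonoidAlgebra F (ℤ × ℤ)) //
        Nat.card (AddMonoidAlgebra F (ℤ × ℤ) ⧸ I) = Nat.card F ^ n} :=
    Nat.card_congr (Equiv.subtypeEquivRight fun I => card_iff I n hn)
  have e : AddMonoidAlgebra F (ℤ × ℤ) ≃+* (F[T;T⁻¹])[T;T⁻¹] := AddMonoidAlgebra.curryRingEquiv
  obtain ⟨e2⟩ := loc_equiv (S := (F[T;T⁻¹])[X]) (A := (F[T;T⁻¹])[T;T⁻¹]) X (Nat.card F ^ n) hq0
  rw [h1, card_ideals_congr e, Nat.card_congr e2]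
  refine Nat.card_congr (Equiv.subtypeEquivRight fun I => ?_)
  constructor
  · rintro ⟨⟨z, hz⟩, hI⟩
    exact ⟨⟨good_of_card (F := F) I n hI, ⟨_, hz, by simp⟩, hI.trans_ne hq0⟩, hI⟩
  · rintro ⟨⟨-, ⟨p, hp, hp0⟩, -⟩, hI⟩
    refine ⟨⟨-p.divX, ?_⟩, hI⟩
    have h := p.divX_mul_X_add
    rw [hp0, C_1] at h
    have : 1 - X * -p.divX = p := by linear_combination h
    rw [this]; exact hp

theorem prod_form (q : ℚ) (N : ℕ → ℚ)
    (hN : ∀ t, t ≠ 0 → N t = (q - 1) ^ 2 * ((q ^ (2 * t) - 1) / (q ^ 2 - 1)))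
    (n : ℕ) (p : n.Partition) :
    p.parts.toFinsupp.prod (fun i e => (q ^ e) ^ (i - 1) * N e) =
    (q - 1) ^ (2 * p.parts.toFinset.card) * q ^ (n - p.parts.card) *
      ∏ i ∈ p.parts.toFinset, ((q ^ (2 * p.parts.count i) - 1) / (q ^ 2 - 1)) := by
  rw [Finsupp.prod, Multiset.toFinsupp_support]
  have h1 : ∀ i ∈ p.parts.toFinset, (q ^ (p.parts.toFinsupp i)) ^ (i - 1) * N (p.parts.toFinsupp i)
      = (q - 1) ^ 2 * q ^ (p.parts.count i * (i - 1)) *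
        ((q ^ (2 * p.parts.count i) - 1) / (q ^ 2 - 1)) := by
    intro i hi
    rw [Multiset.toFinsupp_apply, hN _ (Multiset.count_ne_zero.2 (Multiset.mem_toFinset.1 hi)),
      ← pow_mul]
    ring
  have h2 : ∑ i ∈ p.parts.toFinset, p.parts.count i * (i - 1) = n - p.parts.card := by
    have h3 : ∑ i ∈ p.parts.toFinset, p.parts.count i * (i - 1) + p.parts.card = n := by
      conv_lhs => rw [← Multiset.toFinset_sum_count_eq p.parts, ← Finset.sum_add_distrib]
      conv_rhs => rw [← p.parts_sum, Finset.sum_multiset_count]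
      refine Finset.sum_congr rfl fun i hi => ?_
      have hpos := p.parts_pos (Multiset.mem_toFinset.1 hi)
      obtain ⟨j, rfl⟩ : ∃ j, i = j + 1 := ⟨i - 1, by omega⟩
      simp [mul_add]
    omega
  rw [Finset.prod_congr rfl h1, Finset.prod_mul_distrib, Finset.prod_mul_distrib,
    Finset.prod_const, Finset.prod_pow_eq_pow_sum, h2, ← pow_mul]

end LaurentCount

/-- For a partition `λ` of `n`:
* `ℓ(λ) = λ.parts.card` is the number of parts,
* `v(λ) = λ.parts.toFinset.card` is the number of distinct part sizes,
* `e_i(λ) = λ.parts.count i` is the multiplicity of the part size `i`. -/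
theorem number_of_codim_n_ideals_of_laurent_algebra_eq_sum_over_partitions
    (n : ℕ) (hn : 1 ≤ n) (F : Type*) [Field F] [Fintype F] (q : ℕ)
    (hq : Fintype.card F = q) :
    (Nat.card {I : Ideal (AddMonoidAlgebra F (ℤ × ℤ)) //
        Module.finrank F (AddMonoidAlgebra F (ℤ × ℤ) ⧸ I) = n} : ℚ) =
      ∑ lam : Nat.Partition n,
        ((q : ℚ) - 1) ^ (2 * lam.parts.toFinset.card) * (q : ℚ) ^ (n - lam.parts.card) *
          ∏ i ∈ lam.parts.toFinset,
            (((q : ℚ) ^ (2 * lam.parts.count i) - 1) / ((q : ℚ) ^ 2 - 1)) := by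
  open LaurentCount in
  rw [← Nat.card_eq_fintype_card] at hq
  rw [count_eq n hn, hq]
  have hq2 : 2 ≤ q := by rw [← hq]; exact Finite.one_lt_card
  let Id : ℕ → Finset (Ideal (LaurentPolynomial F)) := fun t => (ideal_finite t).toFinset
  have hId : ∀ t I, I ∈ Id t ↔ Nat.card (LaurentPolynomial F ⧸ I) = q ^ t := by
    intro t I
    rw [← hq]
    exact (ideal_finite t).mem_toFinset
  have hpow : ∀ I : Ideal (LaurentPolynomial F), Nat.card (LaurentPolynomial F ⧸ I) ≠ 0 →
      ∃ t, Nat.card (LaurentPolynomial F ⧸ I) = q ^ t := by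
    rw [← hq]; exact fun I h => card_pow I h
  have hpow' : ∀ I : Ideal (Polynomial (LaurentPolynomial F)), I.toAddSubgroup.index ≠ 0 →
      ∃ t, I.toAddSubgroup.index = q ^ t := by
    rw [← hq]; exact fun I h => card_pow (F := F) I h
  let N : ℕ → ℕ := fun t => ∑ I ∈ Id t, Nat.card (LaurentPolynomial F ⧸ I)ˣ
  have hM : ∀ t, (Id t).card = if t = 0 then 1 else (q - 1) * q ^ (t - 1) := by
    intro t
    rw [← hq, ← ideal_count (F := F) t]
    exact (Nat.card_eq_card_finite_toFinset (ideal_finite t)).symm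
  have hNf := N_formula (q : ℚ) (fun t => ((Id t).card : ℚ)) (fun t => (N t : ℚ))
    (by simp [hM]) (fun t => by
      simp only [hM]
      rw [if_neg (Nat.succ_ne_zero t), Nat.add_sub_cancel, Nat.cast_mul, Nat.cast_sub (by omega)]
      simp)
    (fun t => by
      have := gauss_sum q hq2 hpow Id hId t
      exact_mod_cast this)
  have hq2' : (2 : ℚ) ≤ q := by exact_mod_cast hq2
  have hne : (q : ℚ) ^ 2 - 1 ≠ 0 := by nlinarith
  rw [partition_sum (fun i e => ((q : ℚ) ^ e) ^ (i - 1) * (N e : ℚ))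
    (fun m n => ((S (LaurentPolynomial F) q m n).ncard : ℚ))]
  · refine Finset.sum_congr rfl fun p _ => ?_
    refine prod_form (q : ℚ) (fun t => (N t : ℚ)) ?_ n p
    intro t ht
    obtain ⟨s, rfl⟩ := Nat.exists_eq_succ_of_ne_zero ht
    have := (hNf s).2
    rw [mul_div_assoc', eq_div_iff hne]
    exact this
  · intro n
    simp only [S_zero q n hq2]
    split_ifs <;> simp
  · intro m n
    have h := (S_succ q hq2 hpow hpow' Id hId m (S_finite q hq2 hpow hpow' Id hId m) n).2
    rw [h, Nat.cast_sum]
    refine Finset.sum_congr rfl fun t _ => ?_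
    split_ifs with h1 h2
    · subst h2
      have h0 : (N 0 : ℚ) = 1 := (hNf 0).1
      have h0' : N 0 = 1 := by exact_mod_cast h0
      change (((q ^ 0) ^ m * N 0 * _ : ℕ) : ℚ) = _
      rw [h0']; simp
    · rw [Nat.add_sub_cancel]
      change (((q ^ t) ^ m * N t * _ : ℕ) : ℚ) = _
      push_cast
      rfl
    · simp
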